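/- arXiv:1703.08980 — 2 statements merged into one kernel-verified Lean document; each statement's English description precedes it below -/
import Mathlib

section
/- Let ℓ, r ≥ 2, k ≥ 0, m ∈ ℕ, and let m_1, …, m_ℓ ≥ 0 be integers with (k−1)r + 1 ≤ m_i ≤ kr + 1 for all i. Set c := (ℓ−1)mr. Then the multi-arrangement (A, μ) in ℂ^ℓ with defining polynomial Q(A,μ) = x_1^{m_1} ⋯ x_ℓ^{m_ℓ} · ∏_{1≤i<j≤ℓ} (x_i^r − x_j^r)^{2m} is free with exponents exp(A,μ) = { c + m_1, …, c + m_ℓ }. -/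
open MvPolynomial

noncomputable section

abbrev PolyS (ℓ : ℕ) := MvPolynomial (Fin ℓ) ℂ

/-- Membership in `D(A, μ)` for the multi-arrangement in `ℂ^ℓ` consisting of the
coordinate hyperplanes `ker x_i` with multiplicity `mult0 i` and the hyperplanes
`ker (x_i - ζ x_j)` (for `i < j` and `ζ` an `r`-th root of unity) with
multiplicity `multH`.  (A multiplicity `0` means the hyperplane is absent.) -/
def InDeriv {ℓ : ℕ} (r : ℕ) (mult0 : Fin ℓ → ℕ) (multH : ℕ)
    (θ : Derivation ℂ (PolyS ℓ) (PolyS ℓ)) : Prop :=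
  (∀ i, θ (X i) ∈ Ideal.span {(X i : PolyS ℓ) ^ mult0 i}) ∧
  ∀ i j : Fin ℓ, i < j → ∀ ζ : ℂ, ζ ^ r = 1 →
    θ (X i - C ζ * X j) ∈ Ideal.span {(X i - C ζ * X j : PolyS ℓ) ^ multH}

/-- `θ` is homogeneous of polynomial degree `p`. -/
def IsHomogDeriv {ℓ : ℕ} (θ : Derivation ℂ (PolyS ℓ) (PolyS ℓ)) (p : ℕ) : Prop :=
  ∀ i, (θ (X i)).IsHomogeneous p

/-- The multi-arrangement with derivation-module membership predicate `P` is free with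
exponents `e 0, …, e (ℓ-1)`: there is a basis of the module of derivations consisting
of `ℓ` homogeneous derivations of polynomial degrees `e 0, …, e (ℓ-1)`. -/
def IsFreeWithExponents {ℓ : ℕ} (P : Derivation ℂ (PolyS ℓ) (PolyS ℓ) → Prop)
    (e : Fin ℓ → ℕ) : Prop :=
  ∃ θ : Fin ℓ → Derivation ℂ (PolyS ℓ) (PolyS ℓ),
    (∀ i, P (θ i)) ∧
    LinearIndependent (PolyS ℓ) θ ∧
    (∀ η, P η → η ∈ Submodule.span (PolyS ℓ) (Set.range θ)) ∧
    (∀ i, IsHomogDeriv (θ i) (e i))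

/-- Variant of `IsFreeWithExponents` with the exponents given as integers. -/
def IsFreeWithExponentsZ {ℓ : ℕ} (P : Derivation ℂ (PolyS ℓ) (PolyS ℓ) → Prop)
    (e : Fin ℓ → ℤ) : Prop :=
  ∃ θ : Fin ℓ → Derivation ℂ (PolyS ℓ) (PolyS ℓ),
    (∀ i, P (θ i)) ∧
    LinearIndependent (PolyS ℓ) θ ∧
    (∀ η, P η → η ∈ Submodule.span (PolyS ℓ) (Set.range θ)) ∧
    (∀ i, ∃ p : ℕ, (p : ℤ) = e i ∧ IsHomogDeriv (θ i) p)

namespace Polynomial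

theorem mul_derivative_comp_of_euler {A : Type*} [CommRing A] {e : A} {G D t : A[X]}
    (hG : X * derivative G + C e * G = D) :
    t * derivative (G.comp t) = derivative t * (D.comp t - C e * G.comp t) := by
  rw [derivative_comp, ← hG]
  simp only [add_comp, mul_comp, X_comp, C_comp]
  ring

theorem mul_derivative_pow_self {A : Type*} [CommRing A] (t : A[X]) (n : ℕ) :
    t * derivative (t ^ n) = derivative t * (C (n : A) * t ^ n) := by
  cases n with
  | zero => simp
  | succ n => rw [derivative_pow_succ]; push_cast; ring

theorem pow_dvd_coeff_of_euler {A : Type*} [CommRing A] [Algebra ℚ A] {q d N c : A}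
    {E R : A[X]} (hq : ∀ a, c ∣ q * a → c ∣ a) (h0 : E.coeff 0 = 0)
    (hE : (C q + X * C d) * derivative E = C (d * N) * E + C c * R) (n : ℕ) :
    c ∣ E.coeff n := by
  induction n with
  | zero => rw [h0]; exact dvd_zero c
  | succ n ih =>
    have hX : (X * derivative E).coeff n = n * E.coeff n := by
      cases n with
      | zero => simp
      | succ n => rw [coeff_X_mul, coeff_derivative]; push_cast; ring
    have h := congrArg (fun p => coeff p n) hE
    have hx : (C q + X * C d) * derivative E = C q * derivative E + C d * (X * derivative E) := by
      ring
    simp only [hx, coeff_add, coeff_C_mul, hX, coeff_derivative] at h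
    have hdvd : c ∣ q * (E.coeff (n + 1) * (n + 1)) := by
      rw [show q * (E.coeff (n + 1) * (n + 1)) =
        d * N * E.coeff n + c * R.coeff n - d * (n * E.coeff n) by rw [← h]; ring]
      exact ((ih.mul_left _).add (dvd_mul_right _ _)).sub ((ih.mul_left _).mul_left _)
    have hu : IsUnit ((n : A) + 1) := by
      have : IsUnit ((n : ℚ) + 1) := (by positivity : (n : ℚ) + 1 ≠ 0).isUnit
      simpa using this.map (algebraMap ℚ A)
    exact (IsUnit.dvd_mul_right hu).1 (hq _ hdvd)

/-- If `F = X ^ (P - N) * G` has derivative divisible by `(X - p) ^ α * (X - q) ^ β`, then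
`F p - F q`, after clearing denominators, is divisible by `(p - q) ^ (α + β + 1)`. -/
theorem sub_pow_dvd_of_euler {A : Type*} [CommRing A] [Algebra ℚ A] {p q : A} {P N α β : ℕ}
    {G D : A[X]} (hq : ∀ a, (p - q) ^ (α + β + 1) ∣ q * a → (p - q) ^ (α + β + 1) ∣ a)
    (hG : X * derivative G + C ((P : A) - N) * G = D)
    (hD : (X - C p) ^ α * (X - C q) ^ β ∣ D) :
    (p - q) ^ (α + β + 1) ∣ q ^ N * p ^ P * G.eval p - p ^ N * q ^ P * G.eval q := by
  obtain ⟨g, rfl⟩ := hD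
  set d := p - q with hd
  set t : A[X] := C q + X * C d with ht
  have ht' : derivative t = C d := by simp [t]
  set E : A[X] := C (q ^ N) * t ^ P * G.comp t - C (q ^ P * G.eval q) * t ^ N with hE
  have h1 := mul_derivative_comp_of_euler (t := t) hG
  have hDt : C d * ((X - C p) ^ α * (X - C q) ^ β * g).comp t
      = C (d ^ (α + β + 1)) * ((X - 1) ^ α * X ^ β * g.comp t) := by
    have e1 : t - C p = C d * (X - 1) := by simp [t, hd]; ring
    have e2 : t - C q = C d * X := by simp [t]
    simp only [mul_comp, pow_comp, sub_comp, X_comp, C_comp, e1, e2, C_pow, mul_pow]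
    ring
  have key : t * derivative E = C (d * N) * E + C (d ^ (α + β + 1)) *
      (C (q ^ N) * t ^ P * ((X - 1) ^ α * X ^ β * g.comp t)) := by
    have hP := mul_derivative_pow_self t P
    have hN := mul_derivative_pow_self t N
    rw [ht'] at h1 hP hN
    have : t * derivative E = C (q ^ N) * ((t * derivative (t ^ P)) * G.comp t
        + t ^ P * (t * derivative (G.comp t))) - C (q ^ P * G.eval q) * (t * derivative (t ^ N)) := by
      simp only [hE, derivative_sub, derivative_mul, derivative_C]
      ring
    rw [this, h1, hP, hN]
    simp only [C_mul, C_sub, hE] at hDt ⊢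
    linear_combination C (q ^ N) * t ^ P * hDt
  have h0 : E.coeff 0 = 0 := by
    rw [coeff_zero_eq_eval_zero]
    simp [E, t, eval_comp]
    ring
  have hdvd := pow_dvd_coeff_of_euler hq h0 key
  have : E.eval 1 = q ^ N * p ^ P * G.eval p - p ^ N * q ^ P * G.eval q := by
    simp [E, t, eval_comp, hd]
    ring
  rw [← this, eval_eq_sum]
  exact Finset.dvd_sum fun n _ => (hdvd n).mul_right _

theorem X_sub_C_pow_dvd_of_euler {A : Type*} [CommRing A] [IsDomain A] [CharZero A] {r m : ℕ}
    (hr : r ≠ 0) {e : ℤ} {y : A} (hy : y ≠ 0) {H : A[X]} (hH : H.eval y = 0)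
    (hD : (X - C y) ^ m ∣ (r : A[X]) * X * derivative H + (e : A[X]) * H) :
    (X - C y) ^ (m + 1) ∣ H := by
  suffices h : ∀ n ≤ m, (X - C y) ^ (n + 1) ∣ H from h m le_rfl
  have hprime := prime_X_sub_C y
  have hndvd : ∀ {f : A[X]}, f.eval y ≠ 0 → ¬ (X - C y) ∣ f := fun hf h =>
    hf (dvd_iff_isRoot.1 h)
  intro n
  induction n with
  | zero =>
    intro _
    rw [zero_add, pow_one]
    exact dvd_iff_isRoot.2 hH
  | succ n ih =>
    intro hn
    have h1 := ih (by omega)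
    have h2 : (X - C y) ^ (n + 1) ∣ (r : A[X]) * X * derivative H :=
      (dvd_add_left (h1.mul_left _)).1 ((pow_dvd_pow _ hn).trans hD)
    have h3 : (X - C y) ^ (n + 1) ∣ derivative H :=
      hprime.pow_dvd_of_dvd_mul_left _ (hndvd (by simp [hr, hy])) h2
    obtain ⟨g, rfl⟩ := h1
    have h4 : (X - C y) ^ (n + 1) ∣ (X - C y) ^ n * (((n + 1 : ℕ) : A[X]) * g) := by
      rw [derivative_mul, derivative_X_sub_C_pow,
        dvd_add_left (dvd_mul_right _ _)] at h3
      convert h3 using 1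
      simp only [map_natCast]
      rw [Nat.add_sub_cancel]
      ring
    rw [pow_succ, mul_dvd_mul_iff_left (pow_ne_zero _ hprime.ne_zero)] at h4
    have h5 := (hprime.dvd_or_dvd h4).resolve_left
      (hndvd (by simpa using Nat.cast_add_one_ne_zero n))
    rw [pow_succ _ (n + 1)]
    exact mul_dvd_mul_left _ h5

end Polynomial

theorem ne_zero_of_pow_eq_one {ζ : ℂ} {r : ℕ} (hr : r ≠ 0) (h : ζ ^ r = 1) : ζ ≠ 0 := by
  rintro rfl
  simp [hr] at h

theorem weight_one_eq_degree {σ : Type*} (d : σ →₀ ℕ) : Finsupp.weight 1 d = d.degree := by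
  rw [Finsupp.degree_eq_weight_one]
  rfl

theorem prime_X_sub_C_mul_X {σ : Type*} {i j : σ} (hij : i ≠ j) (ζ : ℂ) :
    Prime (X i - C ζ * X j : MvPolynomial σ ℂ) := by
  classical
  have hne : (X i - C ζ * X j : MvPolynomial σ ℂ).coeff (Finsupp.single i 1) = 1 := by
    have : Finsupp.single j 1 ≠ Finsupp.single i 1 :=
      fun h => hij (Finsupp.single_left_injective one_ne_zero h).symm
    simp [coeff_X, this]
  have hp0 : (X i - C ζ * X j : MvPolynomial σ ℂ) ≠ 0 := fun h => by simp [h] at hne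
  refine (irreducible_of_totalDegree_eq_one ?_ fun x hx => ?_).prime
  · exact ((isHomogeneous_X ℂ i).sub (isHomogeneous_C_mul_X ζ j)).totalDegree hp0
  · exact isUnit_of_dvd_one (hne ▸ hx _)

theorem isRelPrime_of_eval {σ : Type*} {f g : MvPolynomial σ ℂ} (hf : Prime f) (v : σ → ℂ)
    (h0 : eval v f = 0) (h1 : eval v g ≠ 0) : IsRelPrime f g := by
  refine hf.irreducible.isRelPrime_iff_not_dvd.2 ?_
  rintro ⟨h, rfl⟩
  simp [h0] at h1

theorem isRelPrime_X_X {σ : Type*} {i j : σ} (hij : i ≠ j) :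
    IsRelPrime (X i : MvPolynomial σ ℂ) (X j) := by
  classical
  exact isRelPrime_of_eval (X_prime ..) (Pi.single j 1) (by simp [hij]) (by simp)

theorem isRelPrime_X_sub_X {σ : Type*} {i j : σ} (hij : i ≠ j) {ζ : ℂ} (hζ : ζ ≠ 0) (k : σ) :
    IsRelPrime (X i - C ζ * X j : MvPolynomial σ ℂ) (X k) := by
  classical
  refine isRelPrime_of_eval (prime_X_sub_C_mul_X hij ζ) (fun n => if n = i then ζ else 1)
    (by simp [hij.symm]) ?_
  simp only [eval_X]
  split_ifs <;> simp [hζ]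

theorem isRelPrime_X_sub_X_sub {ℓ r : ℕ} (hr : r ≠ 0) {i j k l : Fin ℓ} {ζ ξ : ℂ}
    (hij : i < j) (hkl : k < l) (hζ : ζ ^ r = 1) (hξ : ξ ^ r = 1)
    (hne : (i, j, ζ) ≠ (k, l, ξ)) :
    IsRelPrime (X i - C ζ * X j : PolyS ℓ) (X k - C ξ * X l) := by
  set v : Fin ℓ → ℂ := fun n => if n = i then ζ else if n = j then 1 else (n : ℕ) + 2 with hv
  refine isRelPrime_of_eval (prime_X_sub_C_mul_X hij.ne ζ) v (by simp [v, hij.ne']) ?_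
  have hζ1 := Complex.norm_eq_one_of_pow_eq_one hζ hr
  have hξ1 := Complex.norm_eq_one_of_pow_eq_one hξ hr
  have hn : ∀ n : Fin ℓ, ‖v n‖ = if n = i ∨ n = j then 1 else (n : ℕ) + 2 := by
    intro n
    have : ‖((n : ℕ) + 2 : ℂ)‖ = (n : ℕ) + 2 := by
      exact_mod_cast Complex.norm_natCast ((n : ℕ) + 2)
    by_cases h1 : n = i
    · simp [hv, h1, hζ1]
    · by_cases h2 : n = j
      · simp [hv, h2, hij.ne']
      · simp [hv, h1, h2, this]
  intro h
  simp only [map_sub, map_mul, eval_X, eval_C, sub_eq_zero] at h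
  have hnorm := congrArg norm h
  rw [norm_mul, hξ1, one_mul, hn, hn] at hnorm
  have hkl' : (k : ℕ) < l := hkl
  have hij' : (i : ℕ) < j := hij
  split_ifs at hnorm with h1 h2 h2
  · have hk : k = i := by grind
    have hl : l = j := by grind
    subst hk hl
    simp only [hv, if_true, hij.ne', if_false, mul_one] at h
    exact hne (by rw [h])
  all_goals
    norm_cast at hnorm
    omega

/-- Index set of the hyperplanes `ker (x_i - ζ x_j)`. -/
def rootIndex (ℓ r : ℕ) : Finset ((Fin ℓ × Fin ℓ) × ℂ) :=
  (Finset.univ.filter fun p : Fin ℓ × Fin ℓ => p.1 < p.2) ×ˢ Polynomial.nthRootsFinset r (1 : ℂ)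

theorem mem_rootIndex {ℓ r : ℕ} (hr : 0 < r) {p : (Fin ℓ × Fin ℓ) × ℂ} :
    p ∈ rootIndex ℓ r ↔ p.1.1 < p.1.2 ∧ p.2 ^ r = 1 := by
  simp [rootIndex, Polynomial.mem_nthRootsFinset hr]

theorem card_rootIndex_mul_two {ℓ r : ℕ} (hr : 0 < r) :
    (rootIndex ℓ r).card * 2 = ℓ * (ℓ - 1) * r := by
  have h1 : (Polynomial.nthRootsFinset r (1 : ℂ)).card = r :=
    (Complex.isPrimitiveRoot_exp r hr.ne').card_nthRootsFinset
  have h2 : (Finset.univ.filter fun p : Fin ℓ × Fin ℓ => p.1 < p.2).card =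
      ∑ j ∈ Finset.range ℓ, j := by
    rw [Finset.card_filter, Fintype.sum_prod_type_right,
      ← Fin.sum_univ_eq_sum_range fun j => j]
    refine Finset.sum_congr rfl fun j _ => ?_
    rw [← Finset.card_filter, ← Fin.card_Iio j]
    congr 1
    ext
    simp
  rw [rootIndex, Finset.card_product, h1, h2, mul_right_comm, Finset.sum_range_id_mul_two]

/-- The defining polynomial of the multi-arrangement. -/
def definingPoly {ℓ : ℕ} (r : ℕ) (mi : Fin ℓ → ℕ) (M : ℕ) : PolyS ℓ :=
  (∏ i, X i ^ mi i) * ∏ p ∈ rootIndex ℓ r, (X p.1.1 - C p.2 * X p.1.2) ^ M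

theorem isHomogeneous_definingPoly {ℓ r : ℕ} (hr : 0 < r) (mi : Fin ℓ → ℕ) (m : ℕ) :
    (definingPoly r mi (2 * m)).IsHomogeneous (∑ i, ((ℓ - 1) * m * r + mi i)) := by
  have h1 : (∏ i, X i ^ mi i : PolyS ℓ).IsHomogeneous (∑ i, mi i) :=
    IsHomogeneous.prod _ _ _ fun i _ => isHomogeneous_X_pow i _
  have h2 : (∏ p ∈ rootIndex ℓ r, (X p.1.1 - C p.2 * X p.1.2) ^ (2 * m) : PolyS ℓ).IsHomogeneous
      (∑ p ∈ rootIndex ℓ r, 1 * (2 * m)) :=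
    IsHomogeneous.prod _ _ _ fun p _ =>
      ((isHomogeneous_X ℂ _).sub (isHomogeneous_C_mul_X _ _)).pow _
  have h := h1.mul h2
  rw [← definingPoly] at h
  convert h using 1
  have := card_rootIndex_mul_two (ℓ := ℓ) hr
  rw [Finset.sum_add_distrib, Finset.sum_const, Finset.sum_const, Finset.card_univ,
    Fintype.card_fin, smul_eq_mul, smul_eq_mul]
  linear_combination m * this.symm

theorem definingPoly_ne_zero {ℓ r : ℕ} (hr : 0 < r) (mi : Fin ℓ → ℕ) (M : ℕ) :
    definingPoly r mi M ≠ 0 := by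
  refine mul_ne_zero (Finset.prod_ne_zero_iff.2 fun i _ => pow_ne_zero _ (X_ne_zero i))
    (Finset.prod_ne_zero_iff.2 fun p hp => pow_ne_zero _ ?_)
  exact (prime_X_sub_C_mul_X ((mem_rootIndex hr).1 hp).1.ne _).ne_zero

theorem definingPoly_dvd {ℓ r : ℕ} (hr : 0 < r) (mi : Fin ℓ → ℕ) (M : ℕ) {f : PolyS ℓ}
    (h1 : ∀ i, X i ^ mi i ∣ f)
    (h2 : ∀ i j, i < j → ∀ ζ : ℂ, ζ ^ r = 1 → (X i - C ζ * X j) ^ M ∣ f) :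
    definingPoly r mi M ∣ f := by
  have hz : ∀ {ζ : ℂ}, ζ ^ r = 1 → ζ ≠ 0 := ne_zero_of_pow_eq_one hr.ne'
  refine IsRelPrime.mul_dvd ?_ ?_ ?_
  · refine IsRelPrime.prod_left fun i _ => IsRelPrime.prod_right fun p hp => ?_
    have hp := (mem_rootIndex hr).1 hp
    exact (isRelPrime_X_sub_X hp.1.ne (hz hp.2) i).symm.pow
  · refine Finset.prod_dvd_of_isRelPrime (fun i _ j _ hij => ?_) fun i _ => h1 i
    exact (isRelPrime_X_X hij).pow
  · refine Finset.prod_dvd_of_isRelPrime (fun p hp q hq hpq => ?_) fun p hp => ?_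
    · have hp := (mem_rootIndex hr).1 hp
      have hq := (mem_rootIndex hr).1 hq
      refine (isRelPrime_X_sub_X_sub hr.ne' hp.1 hq.1 hp.2 hq.2 fun h => hpq ?_).pow
      simp only [Prod.mk.injEq] at h
      exact Prod.ext (Prod.ext h.1 h.2.1) h.2.2
    · have hp := (mem_rootIndex hr).1 hp
      exact h2 _ _ hp.1 _ hp.2

theorem inDeriv_iff {ℓ r : ℕ} {mi : Fin ℓ → ℕ} {M : ℕ}
    {θ : Derivation ℂ (PolyS ℓ) (PolyS ℓ)} :
    InDeriv r mi M θ ↔ (∀ i, X i ^ mi i ∣ θ (X i)) ∧ ∀ i j : Fin ℓ, i < j → ∀ ζ : ℂ, ζ ^ r = 1 →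
      (X i - C ζ * X j) ^ M ∣ θ (X i) - C ζ * θ (X j) := by
  simp only [InDeriv, Ideal.mem_span_singleton, map_sub, ← smul_eq_C_mul, Derivation.map_smul]

theorem pow_dvd_det_of_dvd_column {n A : Type*} [Fintype n] [DecidableEq n] [CommRing A]
    {B : Matrix n n A} {c : A} {i : n} (h : ∀ a, c ∣ B a i) : c ∣ B.det := by
  choose v hv using h
  have : B = B.updateCol i (c • v) := by
    ext a b
    by_cases hb : b = i
    · subst hb; simp [hv]
    · simp [Matrix.updateCol_ne hb]
  rw [this, Matrix.det_updateCol_smul]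
  exact dvd_mul_right _ _

theorem definingPoly_dvd_det {ℓ r : ℕ} (hr : 0 < r) {mi : Fin ℓ → ℕ} {M : ℕ}
    {θ : Fin ℓ → Derivation ℂ (PolyS ℓ) (PolyS ℓ)} (hθ : ∀ a, InDeriv r mi M (θ a)) :
    definingPoly r mi M ∣ (Matrix.of fun a i => θ a (X i)).det := by
  simp only [inDeriv_iff] at hθ
  refine definingPoly_dvd hr mi M (fun i => pow_dvd_det_of_dvd_column (i := i) fun a => (hθ a).1 i)
    fun i j hij ζ hζ => ?_
  rw [← Matrix.det_updateCol_add_smul_self _ hij.ne (-C ζ)]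
  refine pow_dvd_det_of_dvd_column (i := i) fun a => ?_
  simpa [sub_eq_add_neg] using (hθ a).2 i j hij ζ hζ

/-- Saito's criterion. -/
theorem isFreeWithExponents_of_det_ne_zero {ℓ r m : ℕ} (hr : 0 < r) {mi : Fin ℓ → ℕ}
    (B : Matrix (Fin ℓ) (Fin ℓ) (PolyS ℓ)) (hB : B.det ≠ 0)
    (hhom : ∀ a i, (B a i).IsHomogeneous ((ℓ - 1) * m * r + mi a))
    (h1 : ∀ a i, X i ^ mi i ∣ B a i)
    (h2 : ∀ a i j, i < j → ∀ ζ : ℂ, ζ ^ r = 1 →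
      (X i - C ζ * X j) ^ (2 * m) ∣ B a i - C ζ * B a j) :
    IsFreeWithExponents (InDeriv r mi (2 * m)) (fun i => (ℓ - 1) * m * r + mi i) := by
  set θ : Fin ℓ → Derivation ℂ (PolyS ℓ) (PolyS ℓ) := fun a => mkDerivation ℂ (B a) with hθdef
  have hθX : ∀ a i, θ a (X i) = B a i := fun a i => mkDerivation_X ..
  have hθ : ∀ a, InDeriv r mi (2 * m) (θ a) := fun a =>
    inDeriv_iff.2 ⟨fun i => by rw [hθX]; exact h1 a i, fun i j hij ζ hζ => by
      rw [hθX, hθX]; exact h2 a i j hij ζ hζ⟩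
  have hsum : ∀ (g : Fin ℓ → PolyS ℓ) i, (∑ a, g a • θ a) (X i) = Matrix.vecMul g B i := by
    intro g i
    have : (∑ a, g a • θ a) (X i) = ∑ a, (g a • θ a) (X i) := by
      rw [← Derivation.coeFnAddMonoidHom_apply, map_sum, Finset.sum_apply]; rfl
    simp [this, Matrix.vecMul, dotProduct, hθX]
  obtain ⟨c, hc⟩ : definingPoly r mi (2 * m) ∣ B.det := by
    have := definingPoly_dvd_det hr hθ
    simp only [hθX] at this
    exact this
  have hdeg : B.det.totalDegree ≤ ∑ i, ((ℓ - 1) * m * r + mi i) := by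
    refine IsHomogeneous.totalDegree_le ?_
    rw [Matrix.det_apply]
    refine IsHomogeneous.sum _ _ _ fun σ _ => ?_
    rw [Units.smul_def, zsmul_eq_mul]
    have hp : (∏ i, B (σ i) i).IsHomogeneous (∑ i, ((ℓ - 1) * m * r + mi (σ i))) :=
      IsHomogeneous.prod _ _ _ fun i _ => hhom _ _
    rw [Equiv.sum_comp σ (fun i => (ℓ - 1) * m * r + mi i)] at hp
    simpa using hp.C_mul ((Equiv.Perm.sign σ : ℤ) : ℂ)
  have hc0 : c ≠ 0 := by
    rintro rfl
    simp [hB] at hc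
  have hQ0 := definingPoly_ne_zero hr mi (2 * m)
  have hcdeg : c.totalDegree = 0 := by
    rw [hc, totalDegree_mul_of_isDomain hQ0 hc0,
      (isHomogeneous_definingPoly hr mi m).totalDegree hQ0] at hdeg
    omega
  have hcu : IsUnit c := by
    rw [totalDegree_eq_zero_iff_eq_C.1 hcdeg] at hc0 ⊢
    exact (isUnit_iff_ne_zero.2 fun h => hc0 (by rw [h, C_0])).map C
  refine ⟨θ, hθ, ?_, ?_, fun a i => by rw [hθX]; exact hhom a i⟩
  · rw [Fintype.linearIndependent_iff]
    intro g hg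
    have : Matrix.vecMul g B = 0 := by
      ext1 i
      rw [← hsum, hg]
      rfl
    exact congrFun (Matrix.eq_zero_of_vecMul_eq_zero hB this)
  · intro η hη
    have hdvd : ∀ a, B.det ∣ (B.updateRow a fun i => η (X i)).det := by
      intro a
      rw [hc, hcu.mul_right_dvd]
      have := definingPoly_dvd_det hr (θ := Function.update θ a η) (mi := mi) (M := 2 * m)
        fun b => by
          by_cases hb : b = a
          · subst hb; simpa using hη
          · simpa [hb] using hθ b
      convert this using 2
      ext1 b i
      by_cases hb : b = a
      · subst hb; simp
      · simp [hb, Matrix.updateRow_ne, hθX]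
    choose g hg using hdvd
    have hη' : η = ∑ a, g a • θ a := by
      refine derivation_ext fun i => ?_
      rw [hsum]
      refine mul_left_cancel₀ hB ?_
      have h := congrFun (Matrix.mulVec_cramer B.transpose fun i => η (X i)) i
      rw [Matrix.mulVec_transpose, Matrix.det_transpose, Pi.smul_apply, smul_eq_mul] at h
      rw [← h]
      have hcr : Matrix.cramer B.transpose (fun i => η (X i)) = B.det • g := by
        ext1 a
        rw [Matrix.cramer_transpose_apply, hg]
        rfl
      rw [hcr, Matrix.smul_vecMul]
      rfl
    rw [hη']
    exact Submodule.sum_mem _ fun a _ => Submodule.smul_mem _ _ (Submodule.subset_span ⟨a, rfl⟩)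

section EulerInverse
open Polynomial (derivative)

/-- A preimage of `D` under `H ↦ r X (dH/dX) + e H`. -/
def eulerInv {ℓ : ℕ} (r : ℕ) (e : ℤ) (D : Polynomial (PolyS ℓ)) : Polynomial (PolyS ℓ) :=
  D.sum fun j a => Polynomial.monomial j (C (((e + r * j : ℤ) : ℂ)⁻¹) * a)

theorem coeff_eulerInv {ℓ : ℕ} (r : ℕ) (e : ℤ) (D : Polynomial (PolyS ℓ)) (j : ℕ) :
    (eulerInv r e D).coeff j = C (((e + r * j : ℤ) : ℂ)⁻¹) * D.coeff j := by
  rw [eulerInv, Polynomial.sum_def, Polynomial.finsetSum_coeff]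
  simp only [Polynomial.coeff_monomial]
  rw [Finset.sum_ite_eq']
  split_ifs with h
  · rfl
  · rw [Polynomial.notMem_support_iff.1 h, mul_zero]

theorem euler_eulerInv {ℓ r : ℕ} {e : ℤ} (he : ∀ j : ℕ, e + r * j ≠ 0)
    (D : Polynomial (PolyS ℓ)) :
    (r : Polynomial (PolyS ℓ)) * Polynomial.X * derivative (eulerInv r e D) +
      (e : Polynomial (PolyS ℓ)) * eulerInv r e D = D := by
  ext1 j
  have hX : (Polynomial.X * derivative (eulerInv r e D)).coeff j = j * (eulerInv r e D).coeff j := by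
    cases j with
    | zero => simp
    | succ j => rw [Polynomial.coeff_X_mul, Polynomial.coeff_derivative]; push_cast; ring
  have hC : C (((e + r * j : ℤ) : ℂ)) * C (((e + r * j : ℤ) : ℂ)⁻¹) = (1 : PolyS ℓ) := by
    rw [← C_mul, mul_inv_cancel₀ (Int.cast_ne_zero.2 (he j)), C_1]
  rw [mul_assoc, Polynomial.coeff_add, ← Polynomial.C_eq_natCast, ← Polynomial.C_eq_intCast,
    Polynomial.coeff_C_mul, Polynomial.coeff_C_mul, hX, coeff_eulerInv]
  have hcast : C (((e + r * j : ℤ) : ℂ)) = (e + r * j : PolyS ℓ) := by simp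
  rw [hcast] at hC
  linear_combination D.coeff j * hC

theorem natDegree_eulerInv_le {ℓ : ℕ} (r : ℕ) (e : ℤ) (D : Polynomial (PolyS ℓ)) :
    (eulerInv r e D).natDegree ≤ D.natDegree :=
  Polynomial.natDegree_le_iff_coeff_eq_zero.2 fun j hj => by
    rw [coeff_eulerInv, Polynomial.coeff_eq_zero_of_natDegree_lt hj, mul_zero]

/-- If `(X - y) ^ m` divides `D`, then `y ^ m` divides the value at `y` of `eulerInv r e D`. -/
theorem pow_dvd_eval_eulerInv {ℓ : ℕ} (r : ℕ) (e : ℤ) {D : Polynomial (PolyS ℓ)} {y : PolyS ℓ}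
    {m : ℕ} (h : (Polynomial.X - Polynomial.C y) ^ m ∣ D) :
    y ^ m ∣ (eulerInv r e D).eval y := by
  obtain ⟨g, rfl⟩ := h
  have hdvd : Polynomial.C (y ^ m) ∣
      ((Polynomial.X - Polynomial.C y) ^ m * g).comp (Polynomial.C y * Polynomial.X) := by
    refine ⟨(Polynomial.X - 1) ^ m * g.comp (Polynomial.C y * Polynomial.X), ?_⟩
    simp only [Polynomial.mul_comp, Polynomial.pow_comp, Polynomial.sub_comp, Polynomial.X_comp,
      Polynomial.C_comp, Polynomial.C_pow]
    rw [show Polynomial.C y * Polynomial.X - Polynomial.C y =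
      Polynomial.C y * (Polynomial.X - 1 : Polynomial (PolyS ℓ)) by ring, mul_pow, mul_assoc]
  rw [Polynomial.C_dvd_iff_dvd_coeff] at hdvd
  rw [Polynomial.eval_eq_sum]
  refine Finset.dvd_sum fun j _ => ?_
  dsimp only
  rw [coeff_eulerInv, mul_assoc]
  refine Dvd.dvd.mul_left ?_ _
  have := hdvd j
  rwa [Polynomial.comp_C_mul_X_coeff] at this

/-- Homogeneity for the grading in which the polynomial variable has degree `r`. -/
def IsJointlyHomogeneous {ℓ : ℕ} (r : ℕ) (D : Polynomial (PolyS ℓ)) (n : ℕ) : Prop :=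
  ∀ j d, coeff d (D.coeff j) ≠ 0 → d.degree + r * j = n

theorem IsJointlyHomogeneous.mul {ℓ r n n' : ℕ} {D D' : Polynomial (PolyS ℓ)}
    (h : IsJointlyHomogeneous r D n) (h' : IsJointlyHomogeneous r D' n') :
    IsJointlyHomogeneous r (D * D') (n + n') := by
  intro j d hd
  rw [Polynomial.coeff_mul, coeff_sum] at hd
  obtain ⟨⟨a, b⟩, hab, hd⟩ := Finset.exists_ne_zero_of_sum_ne_zero hd
  rw [coeff_mul] at hd
  obtain ⟨⟨u, v⟩, huv, hd⟩ := Finset.exists_ne_zero_of_sum_ne_zero hd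
  rw [Finset.HasAntidiagonal.mem_antidiagonal] at hab huv
  dsimp only at hab huv hd
  rw [← h a u (left_ne_zero_of_mul hd), ← h' b v (right_ne_zero_of_mul hd), ← hab, ← huv,
    map_add]
  ring

theorem IsJointlyHomogeneous.one {ℓ r : ℕ} :
    IsJointlyHomogeneous r (1 : Polynomial (PolyS ℓ)) 0 := by
  intro j d hd
  rw [Polynomial.coeff_one] at hd
  split_ifs at hd with hj
  · rw [coeff_one] at hd
    split_ifs at hd with h0
    · simp [← h0, hj]
    · exact absurd rfl hd
  · simp at hd

theorem IsJointlyHomogeneous.pow {ℓ r n : ℕ} {D : Polynomial (PolyS ℓ)}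
    (h : IsJointlyHomogeneous r D n) (m : ℕ) : IsJointlyHomogeneous r (D ^ m) (n * m) := by
  induction m with
  | zero => simpa using IsJointlyHomogeneous.one
  | succ m ih => rw [pow_succ, Nat.mul_succ]; exact ih.mul h

theorem IsJointlyHomogeneous.prod {ι : Type*} {ℓ r : ℕ} (s : Finset ι) (n : ι → ℕ)
    (D : ι → Polynomial (PolyS ℓ)) (h : ∀ i ∈ s, IsJointlyHomogeneous r (D i) (n i)) :
    IsJointlyHomogeneous r (∏ i ∈ s, D i) (∑ i ∈ s, n i) := by
  classical
  induction s using Finset.induction_on with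
  | empty => simpa using IsJointlyHomogeneous.one
  | insert a s ha ih =>
    rw [Finset.prod_insert ha, Finset.sum_insert ha]
    exact (h _ (Finset.mem_insert_self ..)).mul
      (ih fun i hi => h i (Finset.mem_insert_of_mem hi))

theorem isJointlyHomogeneous_X_sub_C {ℓ r : ℕ} (i : Fin ℓ) :
    IsJointlyHomogeneous r (Polynomial.X - Polynomial.C (X i ^ r : PolyS ℓ)) r := by
  intro j d hd
  rw [Polynomial.coeff_sub, Polynomial.coeff_X, Polynomial.coeff_C, coeff_sub] at hd
  by_cases h1 : 1 = j
  · subst h1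
    by_cases h0 : (0 : Fin ℓ →₀ ℕ) = d
    · simp [← h0]
    · simp [coeff_one, h0] at hd
  · by_cases h0 : j = 0
    · subst h0
      have := (isHomogeneous_X_pow (R := ℂ) i r)
      by_contra hne
      refine hd ?_
      rw [if_neg h1, if_pos rfl, this.coeff_eq_zero (by simpa using hne)]
      simp
    · simp [h1, h0] at hd

theorem IsJointlyHomogeneous.eulerInv {ℓ r n : ℕ} {D : Polynomial (PolyS ℓ)}
    (h : IsJointlyHomogeneous r D n) (e : ℤ) : IsJointlyHomogeneous r (eulerInv r e D) n := by
  intro j d hd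
  rw [coeff_eulerInv, coeff_C_mul] at hd
  exact h j d (right_ne_zero_of_mul hd)

theorem IsJointlyHomogeneous.eval {ℓ r n : ℕ} {D : Polynomial (PolyS ℓ)}
    (h : IsJointlyHomogeneous r D n) (i : Fin ℓ) : (D.eval (X i ^ r)).IsHomogeneous n := by
  rw [Polynomial.eval_eq_sum]
  refine IsHomogeneous.sum _ _ _ fun j hj => ?_
  obtain ⟨d, hd⟩ := exists_coeff_ne_zero (Polynomial.mem_support_iff.1 hj)
  have hn := h j d hd
  have hc : (D.coeff j).IsHomogeneous (n - r * j) := by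
    intro d' hd'
    have := h j d' hd'
    rw [weight_one_eq_degree]
    omega
  have := hc.mul ((isHomogeneous_X_pow (R := ℂ) i r).pow j)
  rwa [Nat.sub_add_cancel (by omega)] at this

end EulerInverse

theorem IsHomogeneous.of_X_pow_mul {σ : Type*} {f : MvPolynomial σ ℂ} {i : σ} {N n : ℕ}
    (h : (X i ^ N * f).IsHomogeneous (N + n)) : f.IsHomogeneous n := by
  intro d hd
  have := h (d := Finsupp.single i N + d) (by
    rw [X_pow_eq_monomial, coeff_monomial_mul, one_mul]
    exact hd)
  rw [weight_one_eq_degree] at this ⊢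
  rw [map_add, Finsupp.degree_single] at this
  omega

section Construction
open Polynomial (derivative)

/-- `∏ j, (t - x_j ^ r) ^ m / (t - x_a ^ r)`. -/
def discPoly {ℓ : ℕ} (r m : ℕ) (a : Fin ℓ) : Polynomial (PolyS ℓ) :=
  ∏ j, (Polynomial.X - Polynomial.C (X j ^ r)) ^ (if j = a then m - 1 else m)

theorem sum_ite_eq_pred_add_one {ℓ m : ℕ} (hm : 0 < m) (a : Fin ℓ) :
    ∑ j, (if j = a then m - 1 else m) + 1 = ℓ * m := by
  have h : ∀ j, (if j = a then m - 1 else m) + (if j = a then 1 else 0) = m := by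
    intro j
    split_ifs <;> omega
  have := Finset.sum_congr (rfl : (Finset.univ : Finset (Fin ℓ)) = _) fun j _ => h j
  rw [Finset.sum_add_distrib] at this
  simpa using this

theorem natDegree_discPoly {ℓ r m : ℕ} (hm : 0 < m) (a : Fin ℓ) :
    (discPoly r m a).natDegree + 1 = ℓ * m := by
  rw [discPoly, Polynomial.natDegree_prod_of_monic _ _
    fun j _ => (Polynomial.monic_X_sub_C _).pow _, ← sum_ite_eq_pred_add_one hm a]
  congr 1
  refine Finset.sum_congr rfl fun j _ => ?_
  rw [(Polynomial.monic_X_sub_C _).natDegree_pow, Polynomial.natDegree_X_sub_C, mul_one]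

theorem isJointlyHomogeneous_discPoly {ℓ r m : ℕ} (a : Fin ℓ) :
    IsJointlyHomogeneous r (discPoly r m a) (∑ j, r * (if j = a then m - 1 else m)) :=
  IsJointlyHomogeneous.prod _ _ _ fun j _ => (isJointlyHomogeneous_X_sub_C j).pow _

theorem pow_dvd_discPoly {ℓ r m : ℕ} (a i : Fin ℓ) :
    (Polynomial.X - Polynomial.C (X i ^ r)) ^ (if i = a then m - 1 else m) ∣ discPoly r m a :=
  Finset.dvd_prod_of_mem _ (Finset.mem_univ i)

theorem pow_mul_pow_dvd_discPoly_comp {ℓ r m : ℕ} (a : Fin ℓ) {i j : Fin ℓ} (hij : i ≠ j)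
    {p q : PolyS ℓ} (hp : p ^ r = X i ^ r) (hq : q ^ r = X j ^ r) :
    (Polynomial.X - Polynomial.C p) ^ (if i = a then m - 1 else m) *
      (Polynomial.X - Polynomial.C q) ^ (if j = a then m - 1 else m) ∣
      (discPoly r m a).comp (Polynomial.X ^ r) := by
  have h1 := Finset.prod_dvd_prod_of_subset {i, j} Finset.univ
    (fun j => ((Polynomial.X - Polynomial.C (X j ^ r)) ^ (if j = a then m - 1 else m) :
      Polynomial (PolyS ℓ)).comp (Polynomial.X ^ r)) (Finset.subset_univ _)
  rw [Finset.prod_pair hij, ← Polynomial.prod_comp] at h1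
  refine dvd_trans (mul_dvd_mul ?_ ?_) h1
  · rw [Polynomial.pow_comp, ← hp]
    refine pow_dvd_pow_of_dvd ?_ _
    simpa using sub_dvd_pow_sub_pow Polynomial.X (Polynomial.C p) r
  · rw [Polynomial.pow_comp, ← hq]
    refine pow_dvd_pow_of_dvd ?_ _
    simpa using sub_dvd_pow_sub_pow Polynomial.X (Polynomial.C q) r

/-- The polynomial `H` such that `t ^ ((k - m) r + 1) * H (t ^ r)` is an antiderivative of
`t ^ ((k - m) r) * discPoly r m a (t ^ r)`. -/
def primitivePoly {ℓ : ℕ} (r k m : ℕ) (a : Fin ℓ) : Polynomial (PolyS ℓ) :=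
  eulerInv r ((k * r + 1 : ℕ) - (m * r : ℕ)) (discPoly r m a)

theorem euler_primitivePoly {ℓ r : ℕ} (hr : 2 ≤ r) (k m : ℕ) (a : Fin ℓ) :
    (r : Polynomial (PolyS ℓ)) * Polynomial.X * derivative (primitivePoly r k m a) +
      (((k * r + 1 : ℕ) - (m * r : ℕ) : ℤ) : Polynomial (PolyS ℓ)) * primitivePoly r k m a =
      discPoly r m a := by
  refine euler_eulerInv (fun j hj => ?_) _
  have : (r : ℤ) ∣ 1 := ⟨m - k - j, by push_cast at hj; linear_combination hj⟩
  have := Int.le_of_dvd one_pos this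
  omega

theorem euler_primitivePoly_comp {ℓ r : ℕ} (hr : 2 ≤ r) (k m : ℕ) (a : Fin ℓ) :
    Polynomial.X * derivative ((primitivePoly r k m a).comp (Polynomial.X ^ r)) +
      Polynomial.C (((k * r + 1 : ℕ) : PolyS ℓ) - (m * r : ℕ)) *
        (primitivePoly r k m a).comp (Polynomial.X ^ r) =
      (discPoly r m a).comp (Polynomial.X ^ r) := by
  rw [← euler_primitivePoly hr k m a, Polynomial.derivative_comp, Polynomial.derivative_X_pow]
  obtain ⟨s, rfl⟩ : ∃ s, r = s + 1 := ⟨r - 1, by omega⟩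
  simp
  ring

theorem sub_pow_dvd_primitivePoly {ℓ r : ℕ} (hr : 2 ≤ r) (k : ℕ) {m : ℕ} (a : Fin ℓ)
    {i j : Fin ℓ} (hij : i ≠ j) {ζ : ℂ} (hζ : ζ ^ r = 1) :
    (X i - C ζ * X j) ^ (2 * m) ∣
      X j ^ (m * r) * (X i ^ (k * r + 1) * (primitivePoly r k m a).eval (X i ^ r)) -
      X i ^ (m * r) * (C ζ * X j ^ (k * r + 1) * (primitivePoly r k m a).eval (X j ^ r)) := by
  have hζ0 : ζ ≠ 0 := ne_zero_of_pow_eq_one (by omega) hζ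
  have hpow : ∀ n : ℕ, (C ζ * X j : PolyS ℓ) ^ (n * r) = X j ^ (n * r) := by
    intro n
    rw [mul_pow, ← C_pow, mul_comm n r, pow_mul ζ, hζ, one_pow, C_1, one_mul]
  have hq : (C ζ * X j : PolyS ℓ) ^ r = X j ^ r := by simpa using hpow 1
  have hrel : IsRelPrime (X i - C ζ * X j : PolyS ℓ) (C ζ * X j) :=
    (((isUnit_iff_ne_zero.2 hζ0).map C).isRelPrime_right).mul_right (isRelPrime_X_sub_X hij hζ0 j)
  have key := Polynomial.sub_pow_dvd_of_euler (P := k * r + 1) (N := m * r)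
    (fun f hf => hrel.pow_left.dvd_of_dvd_mul_left hf)
    (euler_primitivePoly_comp hr k m a)
    (pow_mul_pow_dvd_discPoly_comp a hij (p := X i) rfl hq)
  refine (pow_dvd_pow _ ?_).trans (key.trans (dvd_of_eq ?_))
  · split_ifs <;> omega
  · simp only [Polynomial.eval_comp, Polynomial.eval_pow, Polynomial.eval_X, hq, hpow,
      pow_succ _ (k * r)]
    ring

theorem eval_primitivePoly_dvd {ℓ r k m : ℕ} (hm : 0 < m) {mi : Fin ℓ → ℕ}
    (hlow : ∀ i, k * r + 1 ≤ mi i + r) (hhigh : ∀ i, mi i ≤ k * r + 1) (a i : Fin ℓ) :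
    X i ^ (m * r + mi i) ∣ X a ^ (mi a + r - (k * r + 1)) *
      (X i ^ (k * r + 1) * (primitivePoly r k m a).eval (X i ^ r)) := by
  obtain ⟨c, hc⟩ := pow_dvd_eval_eulerInv r ((k * r + 1 : ℕ) - (m * r : ℕ))
    (pow_dvd_discPoly (r := r) (m := m) a i)
  rw [primitivePoly, hc]
  split_ifs with h
  · subst h
    obtain ⟨n, rfl⟩ : ∃ n, m = n + 1 := ⟨m - 1, by omega⟩
    refine ⟨c, ?_⟩
    have : (n + 1) * r + mi i = (mi i + r - (k * r + 1)) + (k * r + 1) + r * n := by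
      have := hlow i
      rw [Nat.sub_add_cancel this]
      ring
    rw [this, Nat.add_sub_cancel, pow_add, pow_add, pow_mul (X i) r n]
    ring
  · refine Dvd.dvd.mul_left ?_ _
    rw [← mul_assoc, ← pow_mul, ← pow_add]
    refine Dvd.dvd.mul_right (pow_dvd_pow _ ?_) _
    have := hhigh i
    rw [mul_comm r m]
    omega

theorem isHomogeneous_eval_primitivePoly {ℓ r k m : ℕ} (hm : 0 < m) {mi : Fin ℓ → ℕ}
    (hlow : ∀ i, k * r + 1 ≤ mi i + r) (a i : Fin ℓ) :
    (X a ^ (mi a + r - (k * r + 1)) *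
      (X i ^ (k * r + 1) * (primitivePoly r k m a).eval (X i ^ r))).IsHomogeneous
        (m * r + ((ℓ - 1) * m * r + mi a)) := by
  rw [primitivePoly]
  convert (isHomogeneous_X_pow (R := ℂ) a (mi a + r - (k * r + 1))).mul
    ((isHomogeneous_X_pow (R := ℂ) i (k * r + 1)).mul
      (((isJointlyHomogeneous_discPoly (r := r) (m := m) a).eulerInv
        ((k * r + 1 : ℕ) - (m * r : ℕ))).eval i)) using 1
  have h1 := sum_ite_eq_pred_add_one hm a
  have h2 := hlow a
  obtain ⟨n, rfl⟩ : ∃ n, ℓ = n + 1 := ⟨ℓ - 1, by have := a.pos; omega⟩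
  rw [← Finset.mul_sum]
  zify [h2] at h1 ⊢
  rw [Nat.add_sub_cancel]
  linear_combination -(r : ℤ) * h1

theorem X_pow_sub_X_pow_ne_zero {ℓ r : ℕ} (hr : r ≠ 0) {i j : Fin ℓ} (hij : i ≠ j) :
    (X i ^ r - X j ^ r : PolyS ℓ) ≠ 0 := fun h => by
  have := congrArg (eval (Pi.single i 1)) h
  simp [hij.symm, hr] at this

theorem eq_zero_of_sum_discPoly_eq_zero {ℓ r m : ℕ} (hr : r ≠ 0) (hm : 0 < m) {h : Fin ℓ → PolyS ℓ}
    (hsum : ∑ a, Polynomial.C (h a) * discPoly r m a = 0) (a : Fin ℓ) : h a = 0 := by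
  obtain ⟨n, rfl⟩ : ∃ n, m = n + 1 := ⟨m - 1, by omega⟩
  set z : Polynomial (PolyS ℓ) := Polynomial.X - Polynomial.C (X a ^ r) with hz
  have hz0 : z ≠ 0 := Polynomial.X_sub_C_ne_zero _
  rw [← Finset.add_sum_erase _ _ (Finset.mem_univ a)] at hsum
  have h1 : z ^ (n + 1) ∣ ∑ b ∈ Finset.univ.erase a, Polynomial.C (h b) * discPoly r (n + 1) b := by
    refine Finset.dvd_sum fun b hb => Dvd.dvd.mul_left ?_ _
    have := pow_dvd_discPoly (r := r) (m := n + 1) b a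
    rwa [if_neg (Finset.ne_of_mem_erase hb).symm] at this
  have h2 : z ^ (n + 1) ∣ Polynomial.C (h a) * discPoly r (n + 1) a := by
    rw [← dvd_add_left h1, hsum]
    exact dvd_zero _
  rw [discPoly, ← Finset.mul_prod_erase _ _ (Finset.mem_univ a), if_pos rfl, Nat.add_sub_cancel,
    mul_left_comm, pow_succ, mul_dvd_mul_iff_left (pow_ne_zero _ hz0), hz,
    Polynomial.dvd_iff_isRoot, Polynomial.IsRoot.def, Polynomial.eval_mul, Polynomial.eval_C,
    Polynomial.eval_prod] at h2
  refine (mul_eq_zero.1 h2).resolve_right (Finset.prod_ne_zero_iff.2 fun b hb => ?_)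
  simp only [Polynomial.eval_pow, Polynomial.eval_sub, Polynomial.eval_X, Polynomial.eval_C]
  exact pow_ne_zero _ (X_pow_sub_X_pow_ne_zero hr (Finset.ne_of_mem_erase hb).symm)

/-- The values of the primitive polynomials at the points `x_i ^ r` are linearly independent. -/
theorem eq_zero_of_sum_eval_primitivePoly_eq_zero {ℓ r : ℕ} (hr : 2 ≤ r) (k : ℕ) {m : ℕ}
    (hm : 0 < m) {h : Fin ℓ → PolyS ℓ}
    (hsum : ∀ i, ∑ a, h a * (primitivePoly r k m a).eval (X i ^ r) = 0) (a : Fin ℓ) : h a = 0 := by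
  have hr0 : r ≠ 0 := by omega
  obtain ⟨n, rfl⟩ : ∃ n, m = n + 1 := ⟨m - 1, by omega⟩
  set e : ℤ := (k * r + 1 : ℕ) - ((n + 1) * r : ℕ) with he
  set H := ∑ a, Polynomial.C (h a) * primitivePoly r k (n + 1) a with hH
  have hL : (r : Polynomial (PolyS ℓ)) * Polynomial.X * derivative H + (e : Polynomial (PolyS ℓ)) * H =
      ∑ a, Polynomial.C (h a) * discPoly r (n + 1) a := by
    rw [hH, Polynomial.derivative_sum, Finset.mul_sum, Finset.mul_sum, ← Finset.sum_add_distrib]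
    refine Finset.sum_congr rfl fun b _ => ?_
    rw [← euler_primitivePoly hr k (n + 1) b, Polynomial.derivative_C_mul]
    ring
  have hdvd : ∀ i, (Polynomial.X - Polynomial.C (X i ^ r)) ^ (n + 1) ∣ H := by
    intro i
    refine Polynomial.X_sub_C_pow_dvd_of_euler hr0 (e := e) (pow_ne_zero r (X_ne_zero i)) ?_ ?_
    · simpa [hH, Polynomial.eval_finsetSum] using hsum i
    · rw [hL]
      refine Finset.dvd_sum fun b _ => Dvd.dvd.mul_left ?_ _
      refine (pow_dvd_pow _ ?_).trans (pow_dvd_discPoly (r := r) (m := n + 1) b i)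
      split_ifs <;> omega
  have hprod : ∏ i, (Polynomial.X - Polynomial.C (X i ^ r : PolyS ℓ)) ^ (n + 1) ∣ H := by
    refine Finset.prod_dvd_of_isRelPrime (fun i _ j _ hij => ?_) fun i _ => hdvd i
    refine IsRelPrime.pow ((Polynomial.prime_X_sub_C _).irreducible.isRelPrime_iff_not_dvd.2 ?_)
    rw [Polynomial.dvd_iff_isRoot]
    simpa using X_pow_sub_X_pow_ne_zero hr0 hij
  have hdeg : H.natDegree < ℓ * (n + 1) := by
    refine lt_of_le_of_lt (Polynomial.natDegree_sum_le_of_forall_le (n := ℓ * (n + 1) - 1) _ _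
      fun b _ => ?_) (Nat.sub_lt (Nat.mul_pos a.pos hm) one_pos)
    refine (Polynomial.natDegree_C_mul_le _ _).trans ((natDegree_eulerInv_le _ _ _).trans ?_)
    have := natDegree_discPoly (r := r) hm b
    omega
  have hH0 : H = 0 := by
    refine Polynomial.eq_zero_of_dvd_of_natDegree_lt hprod (hdeg.trans_le (le_of_eq ?_))
    rw [Polynomial.natDegree_prod_of_monic _ _ fun j _ => (Polynomial.monic_X_sub_C _).pow _]
    rw [Finset.sum_congr rfl fun j _ => by
      rw [(Polynomial.monic_X_sub_C _).natDegree_pow, Polynomial.natDegree_X_sub_C, mul_one]]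
    simp
  refine eq_zero_of_sum_discPoly_eq_zero hr0 hm ?_ a
  rw [← hL, hH0]
  simp

end Construction

theorem isFreeWithExponents_of_pos {ℓ r k m : ℕ} (hr : 2 ≤ r) (hm : 0 < m) {mi : Fin ℓ → ℕ}
    (hlow : ∀ i, k * r + 1 ≤ mi i + r) (hhigh : ∀ i, mi i ≤ k * r + 1) :
    IsFreeWithExponents (InDeriv r mi (2 * m)) (fun i => (ℓ - 1) * m * r + mi i) := by
  have hex : ∀ a i : Fin ℓ, ∃ f : PolyS ℓ, X i ^ mi i ∣ f ∧
      X i ^ (m * r) * f = X a ^ (mi a + r - (k * r + 1)) *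
        (X i ^ (k * r + 1) * (primitivePoly r k m a).eval (X i ^ r)) := by
    intro a i
    obtain ⟨c, hc⟩ := eval_primitivePoly_dvd hm hlow hhigh a i
    exact ⟨X i ^ mi i * c, dvd_mul_right _ _, by rw [hc, pow_add, mul_assoc]⟩
  choose B hB1 hB using hex
  have hX : ∀ (i : Fin ℓ) n, (X i ^ n : PolyS ℓ) ≠ 0 := fun i n => pow_ne_zero n (X_ne_zero i)
  refine isFreeWithExponents_of_det_ne_zero (by omega) (Matrix.of B) ?_ ?_ hB1 ?_
  · intro hdet
    obtain ⟨v, hv, hvB⟩ := Matrix.exists_vecMul_eq_zero_iff.2 hdet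
    refine hv (funext fun a => ?_)
    have := eq_zero_of_sum_eval_primitivePoly_eq_zero hr k hm
      (h := fun a => v a * X a ^ (mi a + r - (k * r + 1))) (fun i => ?_) a
    · exact (mul_eq_zero.1 this).resolve_right (hX _ _)
    · have hi := congrFun hvB i
      simp only [Matrix.vecMul, dotProduct, Matrix.of_apply, Pi.zero_apply] at hi
      refine (mul_eq_zero.1 ?_).resolve_left (hX i (k * r + 1))
      rw [← mul_zero (X i ^ (m * r)), ← hi, Finset.mul_sum, Finset.mul_sum]
      refine Finset.sum_congr rfl fun b _ => ?_
      linear_combination -(v b) * hB b i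
  · intro a i
    refine IsHomogeneous.of_X_pow_mul (i := i) (N := m * r) ?_
    rw [Matrix.of_apply, hB]
    exact isHomogeneous_eval_primitivePoly hm hlow a i
  · intro a i j hij ζ hζ
    have hζ0 : ζ ≠ 0 := ne_zero_of_pow_eq_one (by omega) hζ
    have key := (sub_pow_dvd_primitivePoly hr k (m := m) a hij.ne hζ).mul_left
      (X a ^ (mi a + r - (k * r + 1)))
    have heq : X a ^ (mi a + r - (k * r + 1)) * (X j ^ (m * r) * (X i ^ (k * r + 1) *
        (primitivePoly r k m a).eval (X i ^ r)) - X i ^ (m * r) * (C ζ * X j ^ (k * r + 1) *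
        (primitivePoly r k m a).eval (X j ^ r))) =
        X i ^ (m * r) * (X j ^ (m * r) * (B a i - C ζ * B a j)) := by
      linear_combination -X j ^ (m * r) * hB a i + X i ^ (m * r) * C ζ * hB a j
    rw [heq] at key
    have hrel : ∀ n, IsRelPrime ((X i - C ζ * X j : PolyS ℓ) ^ (2 * m)) (X n ^ (m * r)) :=
      fun n => (isRelPrime_X_sub_X hij.ne hζ0 n).pow
    exact (hrel j).dvd_of_dvd_mul_left ((hrel i).dvd_of_dvd_mul_left key)

theorem stmt9 (ℓ r k m : ℕ) (hℓ : 2 ≤ ℓ) (hr : 2 ≤ r)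
    (mi : Fin ℓ → ℕ)
    (hlow : ∀ i, ((k : ℤ) - 1) * r + 1 ≤ (mi i : ℤ))
    (hhigh : ∀ i, mi i ≤ k * r + 1) :
    IsFreeWithExponents (InDeriv r mi (2 * m))
      (fun i => (ℓ - 1) * m * r + mi i) := by
  rcases Nat.eq_zero_or_pos m with rfl | hm
  · refine isFreeWithExponents_of_det_ne_zero (by omega)
      (Matrix.diagonal fun i => X i ^ mi i) ?_ ?_ ?_ ?_
    · rw [Matrix.det_diagonal]
      exact Finset.prod_ne_zero_iff.2 fun i _ => pow_ne_zero _ (X_ne_zero i)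
    · intro a i
      rw [Matrix.diagonal_apply]
      split_ifs
      · simpa using isHomogeneous_X_pow a (mi a)
      · exact isHomogeneous_zero _ _ _
    · intro a i
      rw [Matrix.diagonal_apply]
      split_ifs with h
      · rw [h]
      · exact dvd_zero _
    · intro a i j _ ζ _
      simp
  · refine isFreeWithExponents_of_pos hr hm (fun i => ?_) hhigh
    have := hlow i
    zify
    linarith
end
end

section
/- Let r ≥ 2, m ≥ 1, k ≥ 0, and let 0 ≤ m̃_1, m̃_2 ≤ r be integers; set m_i := (k−1)r + 1 + m̃_i for i = 1, 2 and assume m_1, m_2 ≥ 0. Set c := (k−1+m)r + 1. Then the multi-arrangement (A, μ) in ℂ² with defining polynomial Q(A,μ) = x^{m_1} y^{m_2} (x^r − y^r)^{2m+1} is free with exponents exp(A,μ) = { c + m̃_1 + m̃_2, c + r }. -/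
open MvPolynomial

noncomputable section

open Finset in
/-- The weights are those of the divided difference at the nodes `v i`. -/
lemma exists_ne_zero_sum_mul_choose_eq_zero {ι : Type*} [DecidableEq ι] (s : Finset ι)
    (v : ι → ℕ) (hv : Set.InjOn v s) {N : ℕ} (hs : #s = N + 1) :
    ∃ c : ι → ℂ, (∀ i ∈ s, c i ≠ 0) ∧
      ∀ j < N, ∑ i ∈ s, c i * ((v i).choose j : ℂ) = 0 := by
  have hw : Set.InjOn (fun i => (v i : ℂ)) s := fun a ha b hb h => hv ha hb (Nat.cast_injective h)
  refine ⟨fun i => (∏ j ∈ s.erase i, ((v i : ℂ) - v j))⁻¹, fun i hi => ?_, fun j hj => ?_⟩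
  · refine inv_ne_zero (Finset.prod_ne_zero_iff.2 fun j hj => ?_)
    rw [Finset.mem_erase] at hj
    exact sub_ne_zero_of_ne fun h => hj.1 (hw hj.2 hi h.symm)
  · have hnat : (descPochhammer ℂ j).natDegree < N := by rwa [descPochhammer_natDegree]
    have hdeg : (descPochhammer ℂ j).degree < #s :=
      Polynomial.degree_le_natDegree.trans_lt (by exact_mod_cast by omega)
    have h := Lagrange.coeff_eq_sum hw hdeg
    rw [hs, Nat.add_sub_cancel, Polynomial.coeff_eq_zero_of_natDegree_lt hnat] at h
    have hfac : (j.factorial : ℂ) ≠ 0 := by exact_mod_cast j.factorial_ne_zero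
    refine (mul_eq_zero.1 ?_).resolve_left hfac
    rw [Finset.mul_sum, h]
    refine Finset.sum_congr rfl fun i _ => ?_
    rw [descPochhammer_eval_eq_descFactorial, Nat.descFactorial_eq_factorial_mul_choose]
    push_cast
    ring

lemma sub_pow_dvd_sum_of_sum_choose_eq_zero {R ι : Type*} [CommRing R] [Algebra ℂ R]
    (s : Finset ι) (v : ι → ℕ) (c : ι → ℂ) {N D : ℕ} (hD : ∀ i ∈ s, v i ≤ D)
    (hc : ∀ j < N, ∑ i ∈ s, c i * ((v i).choose j : ℂ) = 0) (x y : R) :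
    (x - y) ^ N ∣ ∑ i ∈ s, algebraMap ℂ R (c i) * (x ^ v i * y ^ (D - v i)) := by
  have key : ∀ i ∈ s, algebraMap ℂ R (c i) * (x ^ v i * y ^ (D - v i)) =
      ∑ j ∈ Finset.range (D + 1),
        (x - y) ^ j * y ^ (D - j) * algebraMap ℂ R (c i * ((v i).choose j : ℂ)) := by
    intro i hi
    have hx : x ^ v i = ∑ j ∈ Finset.range (v i + 1),
        (x - y) ^ j * y ^ (v i - j) * ((v i).choose j : R) := by
      rw [← add_pow, sub_add_cancel]
    rw [hx, Finset.sum_mul, Finset.mul_sum]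
    refine Finset.sum_subset_zero_on_sdiff
      (Finset.range_subset_range.2 (by have := hD i hi; omega)) (fun j hj => ?_) fun j hj => ?_
    · have : v i < j := by
        simp only [Finset.mem_sdiff, Finset.mem_range] at hj
        omega
      simp [Nat.choose_eq_zero_of_lt this]
    · have h1 : D - j = (v i - j) + (D - v i) := by
        have := hD i hi
        rw [Finset.mem_range] at hj
        omega
      rw [h1, pow_add, map_mul, map_natCast]
      ring
  rw [Finset.sum_congr rfl key, Finset.sum_comm]
  refine Finset.dvd_sum fun j _ => ?_
  rw [← Finset.mul_sum, ← map_sum]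
  rcases lt_or_ge j N with h | h
  · simp [hc j h]
  · exact (pow_dvd_pow _ h).mul_right _ |>.mul_right _

/-- The binary form `∑ a_j x^{jr} y^{(m-j)r}` of degree `m` in `x^r` and `y^r`. -/
def powForm (r m : ℕ) (a : ℕ → ℂ) : PolyS 2 :=
  ∑ j ∈ Finset.range (m + 1), C (a j) * (X 0 ^ (j * r) * X 1 ^ ((m - j) * r))

lemma powForm_isHomogeneous (r m : ℕ) (a : ℕ → ℂ) : (powForm r m a).IsHomogeneous (m * r) := by
  refine IsHomogeneous.sum _ _ _ fun j hj => ?_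
  have h : m * r = 0 + (j * r + (m - j) * r) := by
    rw [← add_mul, zero_add, Nat.add_sub_cancel' (by simpa [Nat.lt_succ_iff] using hj)]
  rw [h]
  exact (isHomogeneous_C _ _).mul ((isHomogeneous_X_pow _ _).mul (isHomogeneous_X_pow _ _))

lemma eval_zero_one_powForm {r : ℕ} (hr : r ≠ 0) (m : ℕ) (a : ℕ → ℂ) :
    eval ![0, 1] (powForm r m a) = a 0 := by
  rw [powForm, map_sum, Finset.sum_eq_single_of_mem 0 (by simp)]
  · simp
  · intro j _ hj
    simp [hj, hr]

lemma derivation_X_sub_C_mul_X (θ : Derivation ℂ (PolyS 2) (PolyS 2)) (ζ : ℂ) :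
    θ (X 0 - C ζ * X 1) = θ (X 0) - C ζ * θ (X 1) := by
  rw [map_sub, ← smul_eq_C_mul, Derivation.map_smul, smul_eq_C_mul]

/-- The derivation `x^A₁ y^A₂ p ∂_x - x^B₁ y^B₂ q ∂_y`, where `p`, `q` are forms in `x^r, y^r`. -/
def powDeriv (r m A₁ A₂ B₁ B₂ : ℕ) (a b : ℕ → ℂ) : Derivation ℂ (PolyS 2) (PolyS 2) :=
  mkDerivation ℂ ![X 0 ^ A₁ * X 1 ^ A₂ * powForm r m a, -(X 0 ^ B₁ * X 1 ^ B₂ * powForm r m b)]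

lemma powDeriv_X_zero (r m A₁ A₂ B₁ B₂ : ℕ) (a b : ℕ → ℂ) :
    powDeriv r m A₁ A₂ B₁ B₂ a b (X 0) = X 0 ^ A₁ * X 1 ^ A₂ * powForm r m a := by
  simp [powDeriv, mkDerivation_X]

lemma powDeriv_X_one (r m A₁ A₂ B₁ B₂ : ℕ) (a b : ℕ → ℂ) :
    powDeriv r m A₁ A₂ B₁ B₂ a b (X 1) = -(X 0 ^ B₁ * X 1 ^ B₂ * powForm r m b) := by
  simp [powDeriv, mkDerivation_X]

lemma powDeriv_isHomogDeriv (r m A₁ A₂ B₁ B₂ : ℕ) (a b : ℕ → ℂ) (h : A₁ + A₂ = B₁ + B₂) :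
    IsHomogDeriv (powDeriv r m A₁ A₂ B₁ B₂ a b) (A₁ + A₂ + m * r) := by
  rw [IsHomogDeriv, Fin.forall_fin_two, powDeriv_X_zero, powDeriv_X_one]
  refine ⟨?_, ?_⟩
  · exact ((isHomogeneous_X_pow _ _).mul (isHomogeneous_X_pow _ _)).mul
      (powForm_isHomogeneous _ _ _)
  · rw [h]
    exact (((isHomogeneous_X_pow _ _).mul (isHomogeneous_X_pow _ _)).mul
      (powForm_isHomogeneous _ _ _)).neg

/-- The coefficients are those of a Padé approximant of `t ^ ((A₁ - B₁) / r)` at `t = 1`. -/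
lemma exists_powDeriv_sub_dvd {r : ℕ} (hr : 2 ≤ r) (m A₁ A₂ B₁ B₂ : ℕ)
    (h : A₁ + A₂ = B₁ + B₂) (hA : A₁ ≡ B₁ + 1 [MOD r]) :
    ∃ a b : ℕ → ℂ, a 0 ≠ 0 ∧ b 0 ≠ 0 ∧ ∀ ζ : ℂ, ζ ^ r = 1 →
      (X 0 - C ζ * X 1 : PolyS 2) ^ (2 * m + 1) ∣
        powDeriv r m A₁ A₂ B₁ B₂ a b (X 0 - C ζ * X 1) := by
  have hne (i j : ℕ) : A₁ + i * r ≠ B₁ + j * r := by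
    intro hij
    have h1 : A₁ ≡ B₁ [MOD r] := by
      have : A₁ + i * r ≡ B₁ + j * r [MOD r] := by rw [hij]
      simpa [Nat.ModEq] using this
    have h2 : B₁ + 0 ≡ B₁ + 1 [MOD r] := h1.symm.trans hA
    have h3 := Nat.ModEq.add_left_cancel' _ h2
    rw [Nat.ModEq, Nat.mod_eq_of_lt (by omega), Nat.mod_eq_of_lt (by omega)] at h3
    omega
  have hB : A₂ + 1 ≡ B₂ [MOD r] := by
    refine Nat.ModEq.add_left_cancel' (B₁) ?_
    rw [← h, add_comm A₂ 1, ← add_assoc]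
    exact hA.symm.add_right _
  let S := (Finset.range (m + 1)).disjSum (Finset.range (m + 1))
  let v : ℕ ⊕ ℕ → ℕ := Sum.elim (fun j => A₁ + j * r) (fun j => B₁ + j * r)
  have hr0 : r ≠ 0 := by omega
  have hv : Set.InjOn v S := by
    rintro (i | i) - (j | j) - hij
    · simpa [v, hr0] using hij
    · exact absurd hij (hne i j)
    · exact absurd hij.symm (hne j i)
    · simpa [v, hr0] using hij
  obtain ⟨c, hc0, hc⟩ := exists_ne_zero_sum_mul_choose_eq_zero S v hv (N := 2 * m + 1)
    (by simp [S]; ring)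
  refine ⟨fun j => c (.inl j), fun j => c (.inr j), hc0 _ (by simp [S]), hc0 _ (by simp [S]),
    fun ζ hζ => ?_⟩
  have hζ0 : ζ ≠ 0 := by
    rintro rfl
    simp [hr0] at hζ
  have hmod {i j : ℕ} (hij : i ≡ j [MOD r]) : ζ ^ i = ζ ^ j := by
    rw [← Nat.div_add_mod i r, ← Nat.div_add_mod j r, pow_add, pow_add, pow_mul, pow_mul, hζ, hij]
    simp
  have hD : ∀ i ∈ S, v i ≤ A₁ + A₂ + m * r := by
    rintro (i | i) hi
    · have : i * r ≤ m * r := Nat.mul_le_mul_right _ (by simp [S] at hi; omega)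
      simp only [v, Sum.elim_inl]
      omega
    · have : i * r ≤ m * r := Nat.mul_le_mul_right _ (by simp [S] at hi; omega)
      simp only [v, Sum.elim_inr]
      omega
  have hdvd := sub_pow_dvd_sum_of_sum_choose_eq_zero S v c hD hc
    (X 0 : PolyS 2) (C ζ * X 1)
  have hexp {E F j : ℕ} (hE : A₁ + A₂ = E + F) (hj : j ∈ Finset.range (m + 1)) :
      A₁ + A₂ + m * r - (E + j * r) = F + (m - j) * r := by
    obtain ⟨k, rfl⟩ := Nat.exists_eq_add_of_le (Nat.lt_succ_iff.1 (Finset.mem_range.1 hj))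
    rw [Nat.add_sub_cancel_left, add_mul]
    omega
  have heq : ∑ i ∈ S, algebraMap ℂ (PolyS 2) (c i) *
      (X 0 ^ v i * (C ζ * X 1) ^ (A₁ + A₂ + m * r - v i)) =
      C (ζ ^ A₂) * powDeriv r m A₁ A₂ B₁ B₂ (fun j => c (.inl j)) (fun j => c (.inr j))
        (X 0 - C ζ * X 1) := by
    rw [Finset.sum_disjSum, derivation_X_sub_C_mul_X, powDeriv_X_zero, powDeriv_X_one, mul_neg, sub_neg_eq_add, mul_add, powForm, powForm]
    simp only [Finset.mul_sum]
    congr 1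
    · refine Finset.sum_congr rfl fun j hj => ?_
      have e : ζ ^ (A₂ + (m - j) * r) = ζ ^ A₂ := hmod (by simp [Nat.ModEq])
      simp only [v, Sum.elim_inl]
      rw [hexp rfl hj, mul_pow, ← C_pow, e, algebraMap_eq]
      ring
    · refine Finset.sum_congr rfl fun j hj => ?_
      have e : ζ ^ (B₂ + (m - j) * r) = ζ ^ A₂ * ζ := by
        rw [← pow_succ]
        exact hmod (Nat.ModEq.trans (by simp [Nat.ModEq]) hB.symm)
      simp only [v, Sum.elim_inr]
      rw [hexp h hj, mul_pow, ← C_pow, e, algebraMap_eq, C_mul]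
      ring
  rw [heq] at hdvd
  have hu : IsUnit (C (ζ ^ A₂) : PolyS 2) := (IsUnit.mk0 _ (pow_ne_zero _ hζ0)).map C
  exact (hu.dvd_mul_left).1 hdvd

/-- The coefficient determinant of two derivations in two variables. -/
def derivDet (θ η : Derivation ℂ (PolyS 2) (PolyS 2)) : PolyS 2 :=
  θ (X 0) * η (X 1) - θ (X 1) * η (X 0)

lemma isRelPrime_of_combinations {p q a b c d : PolyS 2} (h0 : X 0 = a * p + b * q)
    (h1 : X 1 = c * p + d * q) : IsRelPrime p q := by
  intro g hp hq
  have g0 : g ∣ X 0 := h0 ▸ dvd_add (hp.mul_left _) (hq.mul_left _)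
  have g1 : g ∣ X 1 := h1 ▸ dvd_add (hp.mul_left _) (hq.mul_left _)
  have hirr : Irreducible (X 0 : PolyS 2) := (X_prime (R := ℂ) (i := (0 : Fin 2))).irreducible
  rcases hirr.dvd_iff.1 g0 with h | h
  · exact h
  · have : (X 0 : PolyS 2) ∣ X 1 := h.dvd.trans g1
    simp [X_dvd_X] at this

/-- The defining polynomial `x^m₁ y^m₂ (x^r - y^r)^N`. -/
def defPoly (r m₁ m₂ N : ℕ) : PolyS 2 :=
  X 0 ^ m₁ * X 1 ^ m₂ * ∏ ζ ∈ Polynomial.nthRootsFinset r (1 : ℂ), (X 0 - C ζ * X 1) ^ N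

lemma defPoly_isHomogeneous {r : ℕ} (hr : r ≠ 0) (m₁ m₂ N : ℕ) :
    (defPoly r m₁ m₂ N).IsHomogeneous (m₁ + m₂ + r * N) := by
  refine ((isHomogeneous_X_pow _ _).mul (isHomogeneous_X_pow _ _)).mul ?_
  have hcard := (Complex.isPrimitiveRoot_exp r hr).card_nthRootsFinset
  have h := IsHomogeneous.prod (Polynomial.nthRootsFinset r (1 : ℂ))
    (fun ζ => (X 0 - C ζ * X 1 : PolyS 2) ^ N) (fun _ => 1 * N) fun ζ _ => by
      refine IsHomogeneous.pow ((isHomogeneous_X _ _).sub ?_) N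
      simpa using (isHomogeneous_C (Fin 2) ζ).mul (isHomogeneous_X ℂ (1 : Fin 2))
  simpa [hcard] using h

lemma defPoly_dvd {r : ℕ} (hr : r ≠ 0) {m₁ m₂ N : ℕ} {f : PolyS 2} (h0 : X 0 ^ m₁ ∣ f)
    (h1 : X 1 ^ m₂ ∣ f) (h : ∀ ζ : ℂ, ζ ^ r = 1 → (X 0 - C ζ * X 1) ^ N ∣ f) :
    defPoly r m₁ m₂ N ∣ f := by
  have hmem {ζ : ℂ} (hζ : ζ ∈ Polynomial.nthRootsFinset r (1 : ℂ)) : ζ ^ r = 1 :=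
    (Polynomial.mem_nthRootsFinset (by omega) 1).1 hζ
  have hCinv {ζ : ℂ} (hζ : ζ ≠ 0) : (C ζ⁻¹ * C ζ : PolyS 2) = 1 := by
    rw [← C_mul, inv_mul_cancel₀ hζ, C_1]
  refine IsRelPrime.mul_dvd (IsRelPrime.prod_right fun ζ hζ => IsRelPrime.mul_left ?_ ?_)
    (IsRelPrime.mul_dvd ?_ h0 h1) (Finset.prod_dvd_of_isRelPrime (fun ζ _ ξ _ hne => ?_)
      fun ζ hζ => h ζ (hmem hζ))
  · have hζ0 : ζ ≠ 0 := by
      rintro rfl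
      simpa [hr] using hmem hζ
    refine (isRelPrime_of_combinations (a := 1) (b := 0) (c := C ζ⁻¹) (d := -C ζ⁻¹)
      (by ring) ?_).pow
    linear_combination (-X 1) * hCinv hζ0
  · exact (isRelPrime_of_combinations (a := C ζ) (b := 1) (c := 1) (d := 0)
      (by ring) (by ring)).pow
  · exact (isRelPrime_of_combinations (a := 1) (b := 0) (c := 0) (d := 1)
      (by ring) (by ring)).pow
  · have hinv := hCinv (sub_ne_zero_of_ne hne)
    rw [C_sub] at hinv
    refine IsRelPrime.pow (isRelPrime_of_combinations
      (a := -C (ζ - ξ)⁻¹ * C ξ) (b := C (ζ - ξ)⁻¹ * C ζ)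
      (c := -C (ζ - ξ)⁻¹) (d := C (ζ - ξ)⁻¹) ?_ ?_)
    · linear_combination (-X 0) * hinv
    · linear_combination (-X 1) * hinv

lemma defPoly_dvd_derivDet {r : ℕ} (hr : r ≠ 0) {m₁ m₂ N : ℕ}
    {θ η : Derivation ℂ (PolyS 2) (PolyS 2)} (hθ : InDeriv r ![m₁, m₂] N θ)
    (hη : InDeriv r ![m₁, m₂] N η) : defPoly r m₁ m₂ N ∣ derivDet θ η := by
  simp only [InDeriv, Ideal.mem_span_singleton] at hθ hη
  refine defPoly_dvd hr ?_ ?_ fun ζ hζ => ?_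
  · exact dvd_sub ((hθ.1 0).mul_right _) ((hη.1 0).mul_left _)
  · exact dvd_sub ((hη.1 1).mul_left _) ((hθ.1 1).mul_right _)
  · have hdet : derivDet θ η =
        θ (X 0 - C ζ * X 1) * η (X 1) - θ (X 1) * η (X 0 - C ζ * X 1) := by
      simp only [derivDet, derivation_X_sub_C_mul_X]
      ring
    rw [hdet]
    exact dvd_sub ((hθ.2 0 1 (by decide) ζ hζ).mul_right _)
      ((hη.2 0 1 (by decide) ζ hζ).mul_left _)

lemma derivDet_smul (θ φ η : Derivation ℂ (PolyS 2) (PolyS 2)) :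
    derivDet θ φ • η = derivDet η φ • θ - derivDet η θ • φ := by
  refine derivation_ext (Fin.forall_fin_two.2 ⟨?_, ?_⟩) <;>
  · simp only [derivDet, Derivation.sub_apply, Derivation.smul_apply, smul_eq_mul]
    ring

lemma linearIndependent_of_derivDet_ne_zero {θ : Fin 2 → Derivation ℂ (PolyS 2) (PolyS 2)}
    (h : derivDet (θ 0) (θ 1) ≠ 0) : LinearIndependent (PolyS 2) θ := by
  rw [Fintype.linearIndependent_iff]
  intro g hg
  rw [Fin.sum_univ_two] at hg
  have h0 := congrArg (fun D => D (X 0)) hg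
  have h1 := congrArg (fun D => D (X 1)) hg
  simp only [Derivation.add_apply, Derivation.smul_apply, smul_eq_mul,
    Derivation.zero_apply] at h0 h1
  refine Fin.forall_fin_two.2 ⟨?_, ?_⟩ <;> refine (mul_eq_zero.1 ?_).resolve_right h <;>
    rw [derivDet]
  · linear_combination θ 1 (X 1) * h0 - θ 1 (X 0) * h1
  · linear_combination θ 0 (X 0) * h1 - θ 0 (X 1) * h0

/-- Saito's criterion in two variables. -/
lemma isFreeWithExponents_of_derivDet_ne_zero {r : ℕ} (hr : r ≠ 0) {m₁ m₂ N : ℕ}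
    {θ : Fin 2 → Derivation ℂ (PolyS 2) (PolyS 2)} {e : Fin 2 → ℕ}
    (hθ : ∀ i, InDeriv r ![m₁, m₂] N (θ i)) (he : ∀ i, IsHomogDeriv (θ i) (e i))
    (hdet : derivDet (θ 0) (θ 1) ≠ 0) (hsum : e 0 + e 1 = m₁ + m₂ + r * N) :
    IsFreeWithExponents (InDeriv r ![m₁, m₂] N) e := by
  refine ⟨θ, hθ, linearIndependent_of_derivDet_ne_zero hdet, fun η hη => ?_, he⟩
  obtain ⟨w, hw⟩ := defPoly_dvd_derivDet hr (hθ 0) (hθ 1)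
  have hQ0 : defPoly r m₁ m₂ N ≠ 0 := fun h => hdet (by rw [hw, h, zero_mul])
  have hw0 : w ≠ 0 := fun h => hdet (by rw [hw, h, mul_zero])
  have hdeg : (derivDet (θ 0) (θ 1)).IsHomogeneous (e 0 + e 1) :=
    ((he 0 0).mul (he 1 1)).sub ((he 0 1).mul (he 1 0))
  have hw_deg : w.totalDegree = 0 := by
    have h := hdeg.totalDegree hdet
    rw [hw, totalDegree_mul_of_isDomain hQ0 hw0,
      (defPoly_isHomogeneous hr m₁ m₂ N).totalDegree hQ0] at h
    omega
  have hwC : w = C (coeff 0 w) := totalDegree_eq_zero_iff_eq_C.1 hw_deg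
  have hu : coeff 0 w ≠ 0 := fun h => hw0 (by rw [hwC, h, C_0])
  obtain ⟨g, hg⟩ := defPoly_dvd_derivDet hr hη (hθ 1)
  obtain ⟨f, hf⟩ := defPoly_dvd_derivDet hr hη (hθ 0)
  have hcr := derivDet_smul (θ 0) (θ 1) η
  rw [hw, hg, hf, mul_smul, mul_smul, mul_smul, ← smul_sub] at hcr
  have hη_eq : w • η = g • θ 0 - f • θ 1 := by
    refine derivation_ext fun i => mul_left_cancel₀ hQ0 ?_
    simpa using congrArg (fun D => D (X i)) hcr
  have hηC : η = (C (coeff 0 w)⁻¹ : PolyS 2) • (g • θ 0 - f • θ 1) := by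
    rw [← hη_eq, smul_smul]
    nth_rw 2 [hwC]
    rw [← C_mul, inv_mul_cancel₀ hu, C_1, one_smul]
  rw [hηC]
  have hmem (i : Fin 2) : θ i ∈ Submodule.span (PolyS 2) (Set.range θ) :=
    Submodule.subset_span ⟨i, rfl⟩
  exact Submodule.smul_mem _ _ (Submodule.sub_mem _ (Submodule.smul_mem _ _ (hmem 0))
    (Submodule.smul_mem _ _ (hmem 1)))

lemma powDeriv_inDeriv {r m A₁ A₂ B₁ B₂ m₁ m₂ : ℕ} {a b : ℕ → ℂ} (h₁ : m₁ ≤ A₁) (h₂ : m₂ ≤ B₂)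
    (h : ∀ ζ : ℂ, ζ ^ r = 1 → (X 0 - C ζ * X 1 : PolyS 2) ^ (2 * m + 1) ∣
      powDeriv r m A₁ A₂ B₁ B₂ a b (X 0 - C ζ * X 1)) :
    InDeriv r ![m₁, m₂] (2 * m + 1) (powDeriv r m A₁ A₂ B₁ B₂ a b) := by
  simp only [InDeriv, Ideal.mem_span_singleton]
  refine ⟨Fin.forall_fin_two.2 ⟨?_, ?_⟩, fun i j hij ζ hζ => ?_⟩
  · rw [powDeriv_X_zero]
    exact ((pow_dvd_pow _ h₁).mul_right _).mul_right _
  · rw [powDeriv_X_one]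
    exact (((pow_dvd_pow _ h₂).mul_left _).mul_right _).neg_right
  · obtain ⟨rfl, rfl⟩ : i = 0 ∧ j = 1 := by
      revert i j
      decide
    exact h ζ hζ

lemma derivDet_powDeriv_ne_zero {r : ℕ} (hr : r ≠ 0) {m m₁ m₂ t₁ t₂ n : ℕ}
    (h₁ : n + t₁ = m₁ + r) (h₂ : n + t₂ = m₂ + r) {a b a' b' : ℕ → ℂ} (ha : a 0 ≠ 0)
    (hb' : b' 0 ≠ 0) :
    derivDet (powDeriv r m m₁ t₂ t₁ m₂ a b) (powDeriv r m n 0 0 n a' b') ≠ 0 := by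
  have hfac : derivDet (powDeriv r m m₁ t₂ t₁ m₂ a b) (powDeriv r m n 0 0 n a' b') =
      X 0 ^ m₁ * X 1 ^ m₂ * (X 0 ^ r * (powForm r m b * powForm r m a') -
        X 1 ^ r * (powForm r m a * powForm r m b')) := by
    have e₁ : (X 0 ^ n * X 0 ^ t₁ : PolyS 2) = X 0 ^ m₁ * X 0 ^ r := by rw [← pow_add, h₁, pow_add]
    have e₂ : (X 1 ^ n * X 1 ^ t₂ : PolyS 2) = X 1 ^ m₂ * X 1 ^ r := by rw [← pow_add, h₂, pow_add]
    rw [derivDet, powDeriv_X_zero, powDeriv_X_zero, powDeriv_X_one, powDeriv_X_one]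
    linear_combination (X 1 ^ m₂ * powForm r m b * powForm r m a') * e₁ -
      (X 0 ^ m₁ * powForm r m a * powForm r m b') * e₂
  rw [hfac]
  refine mul_ne_zero (mul_ne_zero (pow_ne_zero _ (X_ne_zero _)) (pow_ne_zero _ (X_ne_zero _)))
    fun h => ?_
  have := congrArg (eval ![0, 1]) h
  simp [eval_zero_one_powForm hr, hr, ha, hb'] at this

theorem stmt11 (r m k : ℕ) (hr : 2 ≤ r) (hm : 1 ≤ m)
    (mt1 mt2 : ℕ) (hmt1 : mt1 ≤ r) (hmt2 : mt2 ≤ r)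
    (m1 m2 : ℕ)
    (hm1 : (m1 : ℤ) = ((k : ℤ) - 1) * r + 1 + mt1)
    (hm2 : (m2 : ℤ) = ((k : ℤ) - 1) * r + 1 + mt2) :
    IsFreeWithExponents (InDeriv r ![m1, m2] (2 * m + 1))
      ![(k + m - 1) * r + 1 + mt1 + mt2, (k + m - 1) * r + 1 + r] := by
  have hn₁ : k * r + 1 + mt1 = m1 + r := by
    zify
    linear_combination -hm1
  have hn₂ : k * r + 1 + mt2 = m2 + r := by
    zify
    linear_combination -hm2
  have hr0 : r ≠ 0 := by omega
  have hmod : m1 ≡ mt1 + 1 [MOD r] := by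
    have h : m1 + r = mt1 + 1 + k * r := by omega
    have h' := congrArg (· % r) h
    simpa [Nat.ModEq] using h'
  obtain ⟨a, b, ha, -, hab⟩ := exists_powDeriv_sub_dvd hr m m1 mt2 mt1 m2 (by omega) hmod
  obtain ⟨a', b', -, hb', hab'⟩ := exists_powDeriv_sub_dvd hr m (k * r + 1) 0 0 (k * r + 1)
    (by omega) (by simp [Nat.ModEq])
  have hkm : (k + m - 1) * r + r = k * r + m * r := by
    obtain ⟨m, rfl⟩ := Nat.exists_eq_add_of_le' hm
    rw [← Nat.add_assoc, Nat.add_sub_cancel]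
    ring
  refine isFreeWithExponents_of_derivDet_ne_zero hr0
    (θ := ![powDeriv r m m1 mt2 mt1 m2 a b, powDeriv r m (k * r + 1) 0 0 (k * r + 1) a' b'])
    (Fin.forall_fin_two.2 ⟨powDeriv_inDeriv le_rfl le_rfl hab,
      powDeriv_inDeriv (by omega) (by omega) hab'⟩)
    (Fin.forall_fin_two.2 ⟨?_, ?_⟩) (derivDet_powDeriv_ne_zero hr0 hn₁ hn₂ ha hb') ?_
  · have h : (k + m - 1) * r + 1 + mt1 + mt2 = m1 + mt2 + m * r := by omega
    simpa [h] using powDeriv_isHomogDeriv r m m1 mt2 mt1 m2 a b (by omega)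
  · have h : (k + m - 1) * r + 1 + r = k * r + 1 + 0 + m * r := by omega
    simpa [h] using powDeriv_isHomogDeriv r m (k * r + 1) 0 0 (k * r + 1) a' b' (by omega)
  · have h : r * (2 * m + 1) = m * r + m * r + r := by ring
    simp only [Matrix.cons_val_zero, Matrix.cons_val_one]
    omega
end
end
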